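/- Fix integers n ≥ 3, k ≥ 1, s ≥ 1, positive integers c₁,…,c_s and positive integers d₁,…,d_{s−1} (the latter list empty when s = 1). Set C̃ = W^(k−1)·(A⁻¹·C)⁻¹ and D̃ = W^k·(A⁻¹·C)⁻¹, and define R = (A^k·C)^{c_s} · (A^{k+1}·C)^{d_{s−1}} · (A^k·C)^{c_{s−1}} · ⋯ · (A^{k+1}·C)^{d₁} · (A^k·C)^{c₁} and L = (A⁻¹·C)^(n−3) · C̃^{c_s} · D̃^{d_{s−1}} · C̃^{c_{s−1}} · ⋯ · D̃^{d₁} · C̃^{c₁−1} · W^(k−1) · A⁻¹. Then (C⁻¹·A·C)·R = L in PSL(2,ℝ). -/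

import Mathlib

open Matrix Real

/-- `SL(2,ℝ)`. -/
abbrev SL2 := Matrix.SpecialLinearGroup (Fin 2) ℝ

/-- The parabolic generator `A = [[1,t],[0,1]]`. -/
noncomputable def Amat (t : ℝ) : SL2 :=
  ⟨!![1, t; 0, 1], by norm_num [Matrix.det_fin_two_of]⟩

/-- The elliptic generator `C = [[0,-1],[1,0]]`. -/
noncomputable def Cmat : SL2 :=
  ⟨!![0, -1; 1, 0], by norm_num [Matrix.det_fin_two_of]⟩

/-- `W = A⁻² · C · (A⁻¹ · C)^(n-3)`, with `t = 2 cos (π / n)`. -/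
noncomputable def Wmat (n : ℕ) : SL2 :=
  (Amat (2 * Real.cos (Real.pi / n)))⁻¹ ^ 2 * Cmat *
    ((Amat (2 * Real.cos (Real.pi / n)))⁻¹ * Cmat) ^ (n - 3)

/-- The alternating word `X^(c m) · Y^(d (m-1)) · X^(c (m-1)) · ⋯ · Y^(d 0) · X^(c 0)`,
where `c 0, …, c m` play the role of `c₁, …, c_s` (so `s = m + 1`) and
`d 0, …, d (m-1)` play the role of `d₁, …, d_{s-1}`. -/
noncomputable def wordProd (X Y : SL2) (c d : ℕ → ℕ) : ℕ → SL2
  | 0 => X ^ c 0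
  | m + 1 => X ^ c (m + 1) * Y ^ d m * wordProd X Y c d m

/-- As `wordProd`, but with final (rightmost) exponent `c 0 - 1` in place of `c 0`:
`X^(c m) · Y^(d (m-1)) · ⋯ · Y^(d 0) · X^(c 0 - 1)`. -/
noncomputable def wordProdL (X Y : SL2) (c d : ℕ → ℕ) : ℕ → SL2
  | 0 => X ^ (c 0 - 1)
  | m + 1 => X ^ c (m + 1) * Y ^ d m * wordProdL X Y c d m

lemma wordProdL_mul (X Y : SL2) (c d : ℕ → ℕ) (hc : 0 < c 0) (m : ℕ) :
    wordProdL X Y c d m * X = wordProd X Y c d m := by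
  induction m with
  | zero => exact pow_sub_one_mul hc.ne' X
  | succ m ih => simp only [wordProdL, wordProd, mul_assoc, ih]

lemma map_wordProd_conj {G : Type*} [Group G] (f : SL2 →* G) {X Y X' Y' : SL2} {v : G}
    (hX : f X' = v * f X * v⁻¹) (hY : f Y' = v * f Y * v⁻¹) (c d : ℕ → ℕ) (m : ℕ) :
    f (wordProd X' Y' c d m) = v * f (wordProd X Y c d m) * v⁻¹ := by
  induction m with
  | zero => simp only [wordProd, map_pow, hX, conj_pow]
  | succ m ih =>
    simp only [wordProd, map_mul, map_pow, hX, hY, conj_pow, ih]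
    group

lemma sin_smul_elliptic_pow (θ : ℝ) (j : ℕ) :
    sin θ • (!![-(2 * cos θ), -1; 1, 0] : Matrix (Fin 2) (Fin 2) ℝ) ^ j =
      (-1 : ℝ) ^ j • !![sin ((j + 1) * θ), sin (j * θ); -sin (j * θ), -sin ((j - 1) * θ)] := by
  induction j with
  | zero => ext a b; fin_cases a <;> fin_cases b <;> simp
  | succ j ih =>
    have h₁ : sin ((j + 1 + 1) * θ) = 2 * cos θ * sin ((j + 1) * θ) - sin (j * θ) := by
      rw [show ((j : ℝ) + 1 + 1) * θ = (j + 1) * θ + θ by ring,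
        show (j : ℝ) * θ = (j + 1) * θ - θ by ring, sin_add, sin_sub]
      ring
    have h₂ : sin ((j + 1) * θ) = 2 * cos θ * sin (j * θ) - sin ((j - 1) * θ) := by
      rw [show ((j : ℝ) + 1) * θ = j * θ + θ by ring,
        show ((j : ℝ) - 1) * θ = j * θ - θ by ring, sin_add, sin_sub]
      ring
    rw [pow_succ, ← smul_mul_assoc, ih]
    ext a b
    fin_cases a <;> fin_cases b <;> simp [Matrix.mul_apply, Fin.sum_univ_two, h₁, pow_succ]
    · ring
    · rw [h₂]; ring

lemma coe_inv_Amat_mul_Cmat (t : ℝ) :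
    (((Amat t)⁻¹ * Cmat : SL2) : Matrix (Fin 2) (Fin 2) ℝ) = !![-t, -1; 1, 0] := by
  rw [Matrix.SpecialLinearGroup.coe_mul, Matrix.SpecialLinearGroup.coe_inv]
  simp [Amat, Cmat, Matrix.adjugate_fin_two_of]

lemma elliptic_pow_mem_center {n : ℕ} (hn : 2 ≤ n) :
    ((Amat (2 * cos (π / n)))⁻¹ * Cmat) ^ n ∈ Subgroup.center SL2 := by
  have hn' : (2 : ℝ) ≤ n := by exact_mod_cast hn
  have hs : sin (π / n) ≠ 0 := by
    refine (sin_pos_of_pos_of_lt_pi (by positivity) ?_).ne'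
    exact div_lt_self pi_pos (by linarith)
  have hnθ : (n : ℝ) * (π / n) = π := by field_simp
  have h := sin_smul_elliptic_pow (π / n) n
  rw [add_mul, sub_mul, hnθ, one_mul, add_comm, sin_add_pi, sin_pi, sin_pi_sub] at h
  rw [Matrix.SpecialLinearGroup.mem_center_iff]
  refine ⟨(-1) ^ (n + 1), by rw [Fintype.card_fin, ← pow_mul, mul_comm, pow_mul]; simp, ?_⟩
  rw [Matrix.SpecialLinearGroup.coe_pow, coe_inv_Amat_mul_Cmat]
  refine smul_right_injective _ hs ?_
  simp only [h]
  ext a b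
  fin_cases a <;> fin_cases b <;> simp [pow_succ, mul_comm]

lemma Cmat_sq_mem_center : Cmat ^ 2 ∈ Subgroup.center SL2 := by
  rw [Matrix.SpecialLinearGroup.mem_center_iff]
  refine ⟨-1, by simp, ?_⟩
  rw [Matrix.SpecialLinearGroup.coe_pow]
  ext a b
  fin_cases a <;> fin_cases b <;> simp [Cmat, pow_two]

lemma coe_eq_or_eq_neg_of_mk_eq {g h : SL2}
    (hgh : QuotientGroup.mk' (Subgroup.center SL2) g = QuotientGroup.mk' (Subgroup.center SL2) h) :
    (g : Matrix (Fin 2) (Fin 2) ℝ) = h ∨ (g : Matrix (Fin 2) (Fin 2) ℝ) = -h := by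
  obtain ⟨z, hz, rfl⟩ := (QuotientGroup.mk'_eq_mk' _).1 hgh
  obtain ⟨r, hr, hrz⟩ := Matrix.SpecialLinearGroup.mem_center_iff.1 hz
  rw [Fintype.card_fin] at hr
  rw [Matrix.SpecialLinearGroup.coe_mul, ← hrz]
  rcases eq_or_eq_neg_of_sq_eq_sq r 1 (by rw [hr, one_pow]) with rfl | rfl
  · simp
  · right
    ext a b
    simp [Matrix.mul_diagonal]

/-- Fix integers `n ≥ 3`, `k ≥ 1`, `s = m + 1 ≥ 1`, positive integers `c₁,…,c_s` and positive
integers `d₁,…,d_{s−1}`.  With `C̃ = W^(k−1)·(A⁻¹·C)⁻¹`, `D̃ = W^k·(A⁻¹·C)⁻¹`,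
`R = (A^k·C)^{c_s}·(A^{k+1}·C)^{d_{s−1}}·(A^k·C)^{c_{s−1}}·⋯·(A^{k+1}·C)^{d₁}·(A^k·C)^{c₁}` and
`L = (A⁻¹·C)^(n−3)·C̃^{c_s}·D̃^{d_{s−1}}·C̃^{c_{s−1}}·⋯·D̃^{d₁}·C̃^{c₁−1}·W^(k−1)·A⁻¹`,
one has `(C⁻¹·A·C)·R = L` in `PSL(2,ℝ)`, i.e., up to sign in `SL(2,ℝ)`. -/
theorem stmt3 (n k : ℕ) (hn : 3 ≤ n) (hk : 1 ≤ k) (m : ℕ) (c d : ℕ → ℕ)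
    (hc : ∀ i ≤ m, 0 < c i) (hd : ∀ i < m, 0 < d i) :
    let A := Amat (2 * Real.cos (Real.pi / n))
    let C := Cmat
    let W := Wmat n
    let Ctilde : SL2 := W ^ (k - 1) * (A⁻¹ * C)⁻¹
    let Dtilde : SL2 := W ^ k * (A⁻¹ * C)⁻¹
    let R : SL2 := wordProd (A ^ k * C) (A ^ (k + 1) * C) c d m
    let L : SL2 := (A⁻¹ * C) ^ (n - 3) * wordProdL Ctilde Dtilde c d m * W ^ (k - 1) * A⁻¹
    (((C⁻¹ * A * C) * R : SL2) : Matrix (Fin 2) (Fin 2) ℝ) = (L : Matrix (Fin 2) (Fin 2) ℝ) ∨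
      (((C⁻¹ * A * C) * R : SL2) : Matrix (Fin 2) (Fin 2) ℝ)
        = -(L : Matrix (Fin 2) (Fin 2) ℝ) := by
  intro A C W Ctilde Dtilde R L
  apply coe_eq_or_eq_neg_of_mk_eq
  set f := QuotientGroup.mk' (Subgroup.center SL2)
  have hC : (f C)⁻¹ = f C := by
    rw [inv_eq_iff_mul_eq_one, ← pow_two, ← map_pow]
    exact (QuotientGroup.eq_one_iff _).2 Cmat_sq_mem_center
  have hU : ((f A)⁻¹ * f C) ^ n = 1 := by
    rw [← map_inv, ← map_mul, ← map_pow]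
    exact (QuotientGroup.eq_one_iff _).2 (elliptic_pow_mem_center (by omega))
  have hCC (x : SL2 ⧸ Subgroup.center SL2) : f C * (f C * x) = x := by
    nth_rewrite 1 [← hC]
    exact inv_mul_cancel_left _ _
  have hUpow : ((f A)⁻¹ * f C) ^ (n - 3) = f C * f A * (f C * f A) * (f C * f A) := by
    rw [pow_sub _ hn, hU, one_mul, ← inv_pow, _root_.mul_inv_rev, inv_inv, hC, pow_three']
  have hW : f W = ((f A)⁻¹ * f C) * f A * ((f A)⁻¹ * f C)⁻¹ := by
    have hdef : f W = (f A)⁻¹ ^ 2 * f C * ((f A)⁻¹ * f C) ^ (n - 3) := by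
      simp only [W, Wmat, map_mul, map_pow, map_inv, A, C]
    rw [hdef, hUpow, pow_two]
    simp only [_root_.mul_inv_rev, inv_inv, hC, hCC, mul_assoc, inv_mul_cancel_left]
  have conj (j : ℕ) : f (W ^ j * (A⁻¹ * C)⁻¹) =
      ((f A)⁻¹ * f C * (f A)⁻¹) * f (A ^ (j + 1) * C) * ((f A)⁻¹ * f C * (f A)⁻¹)⁻¹ := by
    simp only [map_mul, map_pow, map_inv, hW, conj_pow, pow_succ']
    simp only [_root_.mul_inv_rev, inv_inv, hC, mul_assoc, inv_mul_cancel_left]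
  have hCt : f Ctilde = _ := conj (k - 1)
  rw [Nat.sub_add_cancel hk] at hCt
  have hL : L = (A⁻¹ * C) ^ (n - 3) * wordProd Ctilde Dtilde c d m * (A⁻¹ * C * A⁻¹) := by
    rw [← wordProdL_mul _ _ _ _ (hc 0 m.zero_le)]
    simp only [L, Ctilde]
    group
  have hR : f (wordProd Ctilde Dtilde c d m) = _ := map_wordProd_conj f hCt (conj k) c d m
  rw [hL, map_mul f _ R, map_mul f (_ * _) (A⁻¹ * C * A⁻¹), map_mul f ((A⁻¹ * C) ^ (n - 3)), hR]
  simp only [map_mul, map_pow, map_inv, hUpow, R]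
  simp only [_root_.mul_inv_rev, inv_inv, hC, hCC, mul_assoc, mul_inv_cancel_left,
    mul_inv_cancel, mul_one]
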